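/- Fix p_k, p_{k+1} ∈ ℝ², θ ∈ ℝ, feature positions q₁, …, q_N ∈ ℝ², and an index i ∈ {1, …, N}. Let dh_i be the 2 × (3 + 2N) matrix R(θ)ᵀ · (−I₂ | Jᵀ(q_i − p_{k+1}) | 0 | … | I₂ | … | 0), where I₂ occupies the block of the i-th feature. Then dh_i · Φ(p_{k+1}, p_k) · N(p_k, q₁, …, q_N) = 0, where Φ(p', p) = [[I₂, J(p' − p), 0], [0, 1, 0], [0, 0, I_{2N}]] and N(p, q₁, …, q_N) is the (3 + 2N) × 3 matrix with block rows (I₂, Jp), (0, 1), (I₂, Jq₁), …, (I₂, Jq_N). That is, the unobservable subspace remains perpendicular to the linearized measurement after propagation with constant features. -/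

import Mathlib

open Matrix

/-- The 2×2 rotation matrix `R(θ)`. -/
noncomputable def R (θ : ℝ) : Matrix (Fin 2) (Fin 2) ℝ :=
  !![Real.cos θ, -Real.sin θ; Real.sin θ, Real.cos θ]

/-- The 2×2 matrix `J = [[0, −1], [1, 0]]`. -/
def J : Matrix (Fin 2) (Fin 2) ℝ := !![0, -1; 1, 0]

/-- Index type for the `(3 + 2N)`-dimensional state `(p, θ, q₁, …, q_N)`. -/
abbrev Idx (N : ℕ) := Fin 2 ⊕ (Unit ⊕ (Fin N × Fin 2))

/-- Column index type for the 3 columns of the unobservable-subspace matrix. -/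
abbrev Col := Fin 2 ⊕ Unit

/-- The `(3 + 2N) × (3 + 2N)` discrete transition matrix
`Φ(p', p) = [[I₂, J(p' − p), 0], [0, 1, 0], [0, 0, I_{2N}]]`. -/
def Phi (N : ℕ) (p' p : Fin 2 → ℝ) : Matrix (Idx N) (Idx N) ℝ :=
  fun i j =>
    match i, j with
    | .inl a, .inl b => (1 : Matrix (Fin 2) (Fin 2) ℝ) a b
    | .inl a, .inr (.inl _) => (J *ᵥ (p' - p)) a
    | .inr (.inl _), .inr (.inl _) => 1
    | .inr (.inr (k, a)), .inr (.inr (l, b)) =>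
        if k = l then (1 : Matrix (Fin 2) (Fin 2) ℝ) a b else 0
    | _, _ => 0

/-- The `(3 + 2N) × 3` unobservable-subspace matrix `N(p, q₁, …, q_N)` with
block rows `(I₂, Jp), (0, 1), (I₂, Jq₁), …, (I₂, Jq_N)`. -/
def Nmat (N : ℕ) (p : Fin 2 → ℝ) (q : Fin N → Fin 2 → ℝ) : Matrix (Idx N) Col ℝ :=
  fun i j =>
    match i, j with
    | .inl a, .inl b => (1 : Matrix (Fin 2) (Fin 2) ℝ) a b
    | .inl a, .inr _ => (J *ᵥ p) a
    | .inr (.inl _), .inl _ => 0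
    | .inr (.inl _), .inr _ => 1
    | .inr (.inr (_, a)), .inl b => (1 : Matrix (Fin 2) (Fin 2) ℝ) a b
    | .inr (.inr (k, a)), .inr _ => (J *ᵥ (q k)) a

/-- The `2 × (3 + 2N)` linearized measurement matrix
`dh_i = R(θ)ᵀ · (−I₂ | Jᵀ(q_i − p) | 0 | … | I₂ | … | 0)`,
with `I₂` in the `i`-th feature block. -/
noncomputable def dh (N : ℕ) (θ : ℝ) (p : Fin 2 → ℝ) (q : Fin N → Fin 2 → ℝ)
    (i : Fin N) : Matrix (Fin 2) (Idx N) ℝ :=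
  (R θ)ᵀ * (Matrix.of fun a (j : Idx N) =>
    match j with
    | .inl b => -(1 : Matrix (Fin 2) (Fin 2) ℝ) a b
    | .inr (.inl _) => (Jᵀ *ᵥ (q i - p)) a
    | .inr (.inr (k, b)) =>
        if k = i then (1 : Matrix (Fin 2) (Fin 2) ℝ) a b else 0)

theorem transpose_J : _root_.Jᵀ = -_root_.J := by
  ext a b
  fin_cases a <;> fin_cases b <;> simp [_root_.J]

/-- The transition matrix propagates the unobservable subspace to the new robot position. -/
theorem Phi_mul_Nmat (N : ℕ) (p' p : Fin 2 → ℝ) (q : Fin N → Fin 2 → ℝ) :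
    Phi N p' p * Nmat N p q = Nmat N p' q := by
  ext (a | _ | ⟨k, a⟩) (b | _) <;>
    simp [Matrix.mul_apply, Phi, Nmat, Fintype.sum_sum_type, Fintype.sum_prod_type,
      Matrix.one_apply, Matrix.mulVec_sub]

/-- The linearized measurement annihilates the unobservable subspace at the same state. -/
theorem dh_mul_Nmat (N : ℕ) (θ : ℝ) (p : Fin 2 → ℝ) (q : Fin N → Fin 2 → ℝ) (i : Fin N) :
    dh N θ p q i * Nmat N p q = 0 := by
  rw [dh, Matrix.mul_assoc]
  convert Matrix.mul_zero _
  ext a (b | _) <;>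
    simp [Matrix.mul_apply, Nmat, Fintype.sum_sum_type, Fintype.sum_prod_type,
      Matrix.one_apply, Matrix.mulVec_sub, Matrix.neg_mulVec, transpose_J]
  fin_cases a <;> simp <;> ring

/-- The unobservable subspace remains perpendicular to the linearized measurement
after propagation with constant features:
`dh_i(p_{k+1}) · Φ(p_{k+1}, p_k) · N(p_k, q₁, …, q_N) = 0`. -/
theorem dh_after_transition_annihilates_unobservable
    (N : ℕ) (pk pk1 : Fin 2 → ℝ) (θ : ℝ) (q : Fin N → Fin 2 → ℝ) (i : Fin N) :
    dh N θ pk1 q i * (Phi N pk1 pk * Nmat N pk q) = 0 := by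
  rw [Phi_mul_Nmat, dh_mul_Nmat]
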